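/- Let ν be a probability measure on a product measurable space (Ω₁×Ω₂, ℱ₁⊗ℱ₂) with marginals ν₁, ν₂, and P₁, P₂ probability measures on the factors. Then H_{P₁×P₂}(ν) ≥ H_{P₁}(ν₁) + H_{P₂}(ν₂) and H_{P₁×P₂}(ν) ≥ H_{ν₁×ν₂}(ν). -/

import Mathlib

open MeasureTheory

/-- A finite measurable partition of the space, given as a finset of sets. -/
def IsFinPart {Ω : Type*} [MeasurableSpace Ω] (P : Finset (Set Ω)) : Prop :=
  (∀ E ∈ P, MeasurableSet E) ∧ ((P : Set (Set Ω)).PairwiseDisjoint id) ∧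
    ⋃₀ (P : Set (Set Ω)) = Set.univ

/-- The relative-entropy sum `S_Π(P|Q)` with the conventions `0·log(0/q) = 0` and
`p·log(p/0) = +∞` for `p > 0`. -/
noncomputable def partSum {Ω : Type*} [MeasurableSpace Ω] (P Q : Measure Ω)
    (Pt : Finset (Set Ω)) : EReal :=
  ∑ E ∈ Pt, if P E = 0 then (0 : EReal) else if Q E = 0 then ⊤ else
    (((P E).toReal * Real.log ((P E).toReal / (Q E).toReal) : ℝ) : EReal)

/-- The relative entropy `H_Q(P) = sup_Π S_Π(P|Q)` over finite measurable partitions. -/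
noncomputable def relEnt {Ω : Type*} [MeasurableSpace Ω] (P Q : Measure Ω) : EReal :=
  ⨆ Pt ∈ {Pt : Finset (Set Ω) | IsFinPart Pt}, partSum P Q Pt

open InformationTheory in
lemma sum_real_finPart {Ω : Type*} [MeasurableSpace Ω] (P : Measure Ω) [IsProbabilityMeasure P]
    {Pt : Finset (Set Ω)} (h : IsFinPart Pt) : ∑ E ∈ Pt, P.real E = 1 := by
  have := measureReal_biUnion_finset (μ := P) (s := Pt) (f := id) h.2.1 h.1
  have h2 : (⋃ b ∈ Pt, id b) = Set.univ := by
    rw [← h.2.2, Set.sUnion_eq_biUnion]; rfl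
  rw [h2] at this
  simpa using this.symm

open InformationTheory in
lemma partSum_eq {Ω : Type*} [MeasurableSpace Ω] (P Q : Measure Ω) [IsProbabilityMeasure P]
    [IsProbabilityMeasure Q] (hac : P ≪ Q) {Pt : Finset (Set Ω)} (h : IsFinPart Pt) :
    partSum P Q Pt = ((∑ E ∈ Pt, Q.real E * klFun (P.real E / Q.real E) : ℝ) : EReal) := by
  have h1 : ∀ E ∈ Pt, Q.real E * klFun (P.real E / Q.real E)
      = P.real E * Real.log (P.real E / Q.real E) + Q.real E - P.real E := by
    intro E _
    by_cases hq : Q E = 0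
    · have hp := hac hq
      simp [measureReal_def, hq, hp]
    · have : Q.real E ≠ 0 := by simp [measureReal_def, ENNReal.toReal_eq_zero_iff, hq]
      rw [klFun_apply]; field_simp
  rw [Finset.sum_congr rfl h1, Finset.sum_sub_distrib, Finset.sum_add_distrib,
    sum_real_finPart P h, sum_real_finPart Q h, add_sub_cancel_right]
  unfold partSum
  have : ∀ (s : Finset (Set Ω)) (f : Set Ω → ℝ), ((∑ E ∈ s, f E : ℝ) : EReal) = ∑ E ∈ s, (f E : EReal) := by
    intro s f
    exact map_sum (⟨⟨Real.toEReal, rfl⟩, EReal.coe_add⟩ : ℝ →+ EReal) f s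
  rw [this]
  refine Finset.sum_congr rfl fun E _ => ?_
  by_cases hp : P E = 0
  · simp [hp, measureReal_def]
  · have hq : Q E ≠ 0 := fun h => hp (hac h)
    simp [hp, hq, measureReal_def]

open InformationTheory in
lemma klFun_cell_le {Ω : Type*} [MeasurableSpace Ω] (P Q : Measure Ω) [IsProbabilityMeasure P]
    [IsProbabilityMeasure Q] (hac : P ≪ Q)
    (hint : Integrable (fun x => klFun (P.rnDeriv Q x).toReal) Q) (E : Set Ω) :
    Q.real E * klFun (P.real E / Q.real E) ≤ ∫ x in E, klFun (P.rnDeriv Q x).toReal ∂Q := by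
  by_cases hq : Q E = 0
  · simp [measureReal_def, hq, Measure.restrict_eq_zero.2 hq]
  · have hq' : 0 < Q.real E := by
      rw [measureReal_def]; exact ENNReal.toReal_pos hq (measure_ne_top _ _)
    have := convexOn_klFun.map_set_average_le (μ := Q) (t := E)
      (f := fun x => (P.rnDeriv Q x).toReal) continuous_klFun.continuousOn isClosed_Ici hq
      (measure_ne_top _ _) (Filter.Eventually.of_forall fun x => ENNReal.toReal_nonneg)
      Measure.integrable_toReal_rnDeriv.integrableOn hint.integrableOn
    rw [setAverage_eq, setAverage_eq, Measure.setIntegral_toReal_rnDeriv hac, smul_eq_mul,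
      smul_eq_mul, ← div_eq_inv_mul, ← div_eq_inv_mul, le_div_iff₀ hq'] at this
    linarith

open InformationTheory in
lemma relEnt_le_klDiv {Ω : Type*} [MeasurableSpace Ω] (P Q : Measure Ω) [IsProbabilityMeasure P]
    [IsProbabilityMeasure Q] : relEnt P Q ≤ (klDiv P Q : EReal) := by
  refine iSup₂_le fun Pt hPt => ?_
  have h : IsFinPart Pt := hPt
  by_cases htop : klDiv P Q = ⊤
  · simp [htop]
  obtain ⟨hac, hllr⟩ := klDiv_ne_top_iff.1 htop
  have hint := (integrable_klFun_rnDeriv_iff hac).2 hllr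
  rw [partSum_eq P Q hac h, ← EReal.coe_ennreal_toReal htop, toReal_klDiv_eq_integral_klFun hac]
  rw [EReal.coe_le_coe_iff]
  have h2 : (⋃ b ∈ Pt, id b) = Set.univ := by
    rw [← h.2.2, Set.sUnion_eq_biUnion]; rfl
  rw [← setIntegral_univ, ← h2, integral_biUnion_finset (s := id) Pt h.1 h.2.1 fun _ _ => hint.integrableOn]
  exact Finset.sum_le_sum fun E _ => klFun_cell_le P Q hac hint E

lemma relEnt_not_ac {Ω : Type*} [MeasurableSpace Ω] (P Q : Measure Ω) [IsProbabilityMeasure P]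
    [IsProbabilityMeasure Q] (hac : ¬ P ≪ Q) : relEnt P Q = ⊤ := by
  have : ∃ A, MeasurableSet A ∧ Q A = 0 ∧ P A ≠ 0 := by
    by_contra! hcon
    exact hac (Measure.AbsolutelyContinuous.mk hcon)
  obtain ⟨A, hA, hq, hp⟩ := this
  classical
  have hne : A ≠ Aᶜ := by
    intro h
    have h1 : Q Aᶜ = 1 := by rw [prob_compl_eq_one_iff hA, hq]
    rw [← h, hq] at h1
    exact zero_ne_one h1
  have hpart : IsFinPart ({A, Aᶜ} : Finset (Set Ω)) := by
    refine ⟨?_, ?_, ?_⟩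
    · intro E hE
      simp only [Finset.mem_insert, Finset.mem_singleton] at hE
      rcases hE with rfl | rfl
      · exact hA
      · exact hA.compl
    · simp only [Finset.coe_insert, Finset.coe_singleton]
      refine fun E hE F hF hEF => ?_
      rcases hE with rfl | rfl <;> rcases hF with rfl | rfl
      · exact absurd rfl hEF
      · exact disjoint_compl_right
      · exact disjoint_compl_left
      · exact absurd rfl hEF
    · simp
  refine top_unique (le_trans ?_ (le_biSup (partSum P Q) hpart))
  rw [partSum, Finset.sum_pair hne, if_neg hp, if_pos hq, EReal.top_add_of_ne_bot]
  split_ifs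
  · simp
  · simp
  · exact EReal.coe_ne_bot _

open InformationTheory in
/-- The step function attached to a partition. -/
noncomputable def stepKl {Ω : Type*} [MeasurableSpace Ω] (P Q : Measure Ω)
    (Pt : Finset (Set Ω)) (x : Ω) : ENNReal :=
  ∑ E ∈ Pt, E.indicator (fun _ => ENNReal.ofReal (klFun (P.real E / Q.real E))) x

open InformationTheory in
lemma stepKl_apply {Ω : Type*} [MeasurableSpace Ω] (P Q : Measure Ω)
    {Pt : Finset (Set Ω)} (h : IsFinPart Pt) {E : Set Ω} (hE : E ∈ Pt) {x : Ω} (hx : x ∈ E) :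
    stepKl P Q Pt x = ENNReal.ofReal (klFun (P.real E / Q.real E)) := by
  unfold stepKl
  rw [Finset.sum_eq_single_of_mem E hE, Set.indicator_of_mem hx]
  intro F hF hne
  apply Set.indicator_of_notMem
  intro hxF
  exact Set.disjoint_left.1 (h.2.1 hF hE hne) hxF hx

lemma measurable_stepKl {Ω : Type*} [MeasurableSpace Ω] (P Q : Measure Ω)
    {Pt : Finset (Set Ω)} (h : IsFinPart Pt) : Measurable (stepKl P Q Pt) := by
  unfold stepKl
  exact Finset.measurable_fun_sum _ fun E hE => measurable_const.indicator (h.1 E hE)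

open InformationTheory in
lemma lintegral_stepKl_le {Ω : Type*} [MeasurableSpace Ω] (P Q : Measure Ω)
    [IsProbabilityMeasure P] [IsProbabilityMeasure Q] (hac : P ≪ Q)
    {Pt : Finset (Set Ω)} (h : IsFinPart Pt) :
    ((∫⁻ x, stepKl P Q Pt x ∂Q : ENNReal) : EReal) ≤ relEnt P Q := by
  refine le_trans ?_ (le_biSup (partSum P Q) h)
  have h0 : ∀ E, 0 ≤ klFun (P.real E / Q.real E) := fun E => klFun_nonneg (by positivity)
  have : ∫⁻ x, stepKl P Q Pt x ∂Q
      = ENNReal.ofReal (∑ E ∈ Pt, Q.real E * klFun (P.real E / Q.real E)) := by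
    unfold stepKl
    rw [lintegral_finsetSum _ fun E hE => measurable_const.indicator (h.1 E hE),
      ENNReal.ofReal_sum_of_nonneg fun E _ => mul_nonneg measureReal_nonneg (h0 E)]
    refine Finset.sum_congr rfl fun E hE => ?_
    rw [lintegral_indicator_const (h.1 E hE), ENNReal.ofReal_mul measureReal_nonneg,
      ofReal_measureReal, mul_comm]
  rw [this, partSum_eq P Q hac h, EReal.coe_ennreal_ofReal, max_eq_left]
  exact Finset.sum_nonneg fun E _ => mul_nonneg measureReal_nonneg (h0 E)

/-- Level index. -/
noncomputable def lvl {Ω : Type*} (f : Ω → ℝ) (n : ℕ) (x : Ω) : ℕ :=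
  min ⌊((n : ℝ) + 1) * f x⌋₊ ((n + 1) ^ 2)

open Classical in
/-- Partition by levels. -/
noncomputable def lvlPart {Ω : Type*} (f : Ω → ℝ) (n : ℕ) : Finset (Set Ω) :=
  (Finset.range ((n + 1) ^ 2 + 1)).image fun k => lvl f n ⁻¹' {k}

lemma lvl_mem {Ω : Type*} (f : Ω → ℝ) (n : ℕ) (x : Ω) : lvl f n ⁻¹' {lvl f n x} ∈ lvlPart f n := by
  classical
  unfold lvlPart
  refine Finset.mem_image_of_mem (fun k => lvl f n ⁻¹' {k}) (a := lvl f n x) ?_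
  rw [Finset.mem_range, Nat.lt_succ_iff]
  exact min_le_right _ _

lemma isFinPart_lvl {Ω : Type*} [MeasurableSpace Ω] {f : Ω → ℝ} (hf : Measurable f) (n : ℕ) :
    IsFinPart (lvlPart f n) := by
  have hm : Measurable (lvl f n) := by
    unfold lvl
    exact (Nat.measurable_floor.comp (hf.const_mul _)).min measurable_const
  refine ⟨?_, ?_, ?_⟩
  · intro E hE
    simp only [lvlPart, Finset.mem_image] at hE
    obtain ⟨k, _, rfl⟩ := hE
    exact hm (measurableSet_singleton k)
  · intro E hE F hF hne
    simp only [lvlPart, Finset.coe_image, Set.mem_image] at hE hF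
    obtain ⟨k, _, rfl⟩ := hE
    obtain ⟨l, _, rfl⟩ := hF
    refine Set.disjoint_left.2 fun x hx hy => hne ?_
    have hx' : lvl f n x = k := hx
    have hy' : lvl f n x = l := hy
    rw [← hx', ← hy']
  · refine Set.eq_univ_of_forall fun x => ?_
    exact ⟨_, lvl_mem f n x, rfl⟩

lemma lvl_close {Ω : Type*} {f : Ω → ℝ} (hf : ∀ x, 0 ≤ f x) {n : ℕ} {x y : Ω} (hx : f x < n)
    (hy : lvl f n y = lvl f n x) : |f y - f x| ≤ 1 / ((n : ℝ) + 1) := by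
  have hn : (0 : ℝ) < (n : ℝ) + 1 := by positivity
  have h1 : ⌊((n : ℝ) + 1) * f x⌋₊ < (n + 1) ^ 2 := by
    rw [Nat.floor_lt (mul_nonneg hn.le (hf x))]
    push_cast
    nlinarith
  have h2 : ⌊((n : ℝ) + 1) * f y⌋₊ = ⌊((n : ℝ) + 1) * f x⌋₊ := by
    unfold lvl at hy
    omega
  have a1 := Nat.floor_le (mul_nonneg hn.le (hf x))
  have a2 := Nat.floor_le (mul_nonneg hn.le (hf y))
  have b1 := Nat.lt_floor_add_one (((n : ℝ) + 1) * f x)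
  have b2 := Nat.lt_floor_add_one (((n : ℝ) + 1) * f y)
  rw [h2] at a2 b2
  rw [abs_le, ← neg_div, div_le_iff₀ hn, le_div_iff₀ hn]
  constructor <;> nlinarith

lemma ratio_close {Ω : Type*} [MeasurableSpace Ω] (P Q : Measure Ω)
    [IsProbabilityMeasure P] [IsProbabilityMeasure Q] (hac : P ≪ Q) {E : Set Ω}
    (hE : MeasurableSet E) (hq : Q E ≠ 0) {a ε : ℝ}
    (h : ∀ y ∈ E, |(P.rnDeriv Q y).toReal - a| ≤ ε) : |P.real E / Q.real E - a| ≤ ε := by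
  have hq' : 0 < Q.real E := by
    rw [measureReal_def]; exact ENNReal.toReal_pos hq (measure_ne_top _ _)
  have hi : IntegrableOn (fun x => (P.rnDeriv Q x).toReal) E Q :=
    Measure.integrable_toReal_rnDeriv.integrableOn
  have hc : ∀ c : ℝ, IntegrableOn (fun _ : Ω => c) E Q := fun c => integrableOn_const
  have h1 := setIntegral_mono_on (hc (a - ε)) hi hE fun y hy => by
    have := (abs_le.1 (h y hy)).1; linarith
  have h2 := setIntegral_mono_on hi (hc (a + ε)) hE fun y hy => by
    have := (abs_le.1 (h y hy)).2; linarith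
  rw [Measure.setIntegral_toReal_rnDeriv hac, setIntegral_const, smul_eq_mul] at h1 h2
  rw [abs_le]
  constructor
  · have := (le_div_iff₀ hq').2 ((mul_comm _ _).trans_le h1); linarith
  · have := (div_le_iff₀ hq').2 (h2.trans_eq (mul_comm _ _)); linarith

open InformationTheory Filter Topology in
lemma klDiv_le_relEnt {Ω : Type*} [MeasurableSpace Ω] (P Q : Measure Ω) [IsProbabilityMeasure P]
    [IsProbabilityMeasure Q] : (klDiv P Q : EReal) ≤ relEnt P Q := by
  by_cases hac : P ≪ Q
  swap
  · rw [relEnt_not_ac P Q hac]; exact le_top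
  set f : Ω → ℝ := fun x => (P.rnDeriv Q x).toReal with hfdef
  have hf : Measurable f := (Measure.measurable_rnDeriv P Q).ennreal_toReal
  have hf0 : ∀ x, 0 ≤ f x := fun x => ENNReal.toReal_nonneg
  have hpart := fun n => isFinPart_lvl hf n
  -- almost every point is in no null cell
  have hae : ∀ᵐ x ∂Q, ∀ n, Q (lvl f n ⁻¹' {lvl f n x}) ≠ 0 := by
    rw [ae_all_iff]
    intro n
    have : ∀ᵐ x ∂Q, ∀ k : ℕ, Q (lvl f n ⁻¹' {k}) = 0 → x ∉ lvl f n ⁻¹' {k} := by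
      rw [ae_all_iff]
      intro k
      by_cases h : Q (lvl f n ⁻¹' {k}) = 0
      · filter_upwards [measure_eq_zero_iff_ae_notMem.1 h] with x hx _ using hx
      · simp [h]
    filter_upwards [this] with x hx h0
    exact hx _ h0 rfl
  have hlim : ∀ᵐ x ∂Q, Tendsto (fun n => stepKl P Q (lvlPart f n) x) atTop
      (𝓝 (ENNReal.ofReal (klFun (f x)))) := by
    filter_upwards [hae] with x hx
    have e : (fun n => stepKl P Q (lvlPart f n) x) = fun n => ENNReal.ofReal (klFun
        (P.real (lvl f n ⁻¹' {lvl f n x}) / Q.real (lvl f n ⁻¹' {lvl f n x}))) := by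
      funext n
      exact stepKl_apply P Q (hpart n) (lvl_mem f n x) rfl
    rw [e]
    refine ENNReal.tendsto_ofReal ((continuous_klFun.tendsto _).comp ?_)
    rw [tendsto_iff_dist_tendsto_zero]
    refine squeeze_zero' (Eventually.of_forall fun _ => dist_nonneg) ?_
      tendsto_one_div_add_atTop_nhds_zero_nat
    obtain ⟨N, hN⟩ := exists_nat_gt (f x)
    filter_upwards [eventually_ge_atTop N] with n hn
    rw [Real.dist_eq]
    refine ratio_close P Q hac ((hpart n).1 _ (lvl_mem f n x)) (hx n) fun y hy => ?_
    exact lvl_close hf0 (hN.trans_le (by exact_mod_cast hn)) hy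
  have hle : klDiv P Q ≤ liminf (fun n => ∫⁻ x, stepKl P Q (lvlPart f n) x ∂Q) atTop := by
    rw [klDiv_eq_lintegral_klFun_of_ac hac]
    refine le_trans (le_of_eq (lintegral_congr_ae ?_))
      (lintegral_liminf_le fun n => measurable_stepKl P Q (hpart n))
    filter_upwards [hlim] with x hx using hx.liminf_eq.symm
  have hb : ∀ n, ∫⁻ x, stepKl P Q (lvlPart f n) x ∂Q ≤ (relEnt P Q).toENNReal := fun n => by
    have := EReal.toENNReal_le_toENNReal (lintegral_stepKl_le P Q hac (hpart n))
    simpa using this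
  have h0 : 0 ≤ relEnt P Q :=
    le_trans (EReal.coe_ennreal_nonneg _) (lintegral_stepKl_le P Q hac (hpart 0))
  rw [← EReal.coe_toENNReal h0, EReal.coe_ennreal_le_coe_ennreal_iff]
  refine hle.trans (liminf_le_of_le (by isBoundedDefault) fun b hb' => ?_)
  obtain ⟨n, hn⟩ := hb'.exists
  exact hn.trans (hb n)

open InformationTheory in
lemma relEnt_eq_klDiv {Ω : Type*} [MeasurableSpace Ω] (P Q : Measure Ω) [IsProbabilityMeasure P]
    [IsProbabilityMeasure Q] : relEnt P Q = (klDiv P Q : EReal) :=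
  le_antisymm (relEnt_le_klDiv P Q) (klDiv_le_relEnt P Q)

open InformationTheory in
lemma klDiv_prod_eq {Ω₁ Ω₂ : Type*} [MeasurableSpace Ω₁] [MeasurableSpace Ω₂]
    (P₁ : Measure Ω₁) (P₂ : Measure Ω₂) [IsProbabilityMeasure P₁] [IsProbabilityMeasure P₂]
    (ν : Measure (Ω₁ × Ω₂)) [IsProbabilityMeasure ν] (htop : klDiv ν (P₁.prod P₂) ≠ ⊤) :
    klDiv ν (P₁.prod P₂) = klDiv ν (ν.fst.prod ν.snd) + (klDiv ν.fst P₁ + klDiv ν.snd P₂) := by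
  obtain ⟨hac, hint⟩ := klDiv_ne_top_iff.1 htop
  have t1 : klDiv ν.fst P₁ ≠ ⊤ := by
    refine ne_top_of_le_ne_top htop ?_
    have := klDiv_map_le ν (P₁.prod P₂) measurable_fst
    change klDiv ν.fst (P₁.prod P₂).fst ≤ _ at this
    rwa [Measure.fst_prod] at this
  have t2 : klDiv ν.snd P₂ ≠ ⊤ := by
    refine ne_top_of_le_ne_top htop ?_
    have := klDiv_map_le ν (P₁.prod P₂) measurable_snd
    change klDiv ν.snd (P₁.prod P₂).snd ≤ _ at this
    rwa [Measure.snd_prod] at this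
  obtain ⟨ac1, int1⟩ := klDiv_ne_top_iff.1 t1
  obtain ⟨ac2, int2⟩ := klDiv_ne_top_iff.1 t2
  set f1 := ν.fst.rnDeriv P₁ with hf1
  set f2 := ν.snd.rnDeriv P₂ with hf2
  have m1 : Measurable f1 := Measure.measurable_rnDeriv _ _
  have m2 : Measurable f2 := Measure.measurable_rnDeriv _ _
  have hprod : ν.fst.prod ν.snd = (P₁.prod P₂).withDensity fun z => f1 z.1 * f2 z.2 := by
    rw [← prod_withDensity m1 m2, Measure.withDensity_rnDeriv_eq _ _ ac1,
      Measure.withDensity_rnDeriv_eq _ _ ac2]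
  have mm : Measurable fun z : Ω₁ × Ω₂ => f1 z.1 * f2 z.2 := by fun_prop
  have pos1 : ∀ᵐ z ∂ν, 0 < f1 z.1 :=
    ae_of_ae_map measurable_fst.aemeasurable (Measure.rnDeriv_pos ac1)
  have pos2 : ∀ᵐ z ∂ν, 0 < f2 z.2 :=
    ae_of_ae_map measurable_snd.aemeasurable (Measure.rnDeriv_pos ac2)
  have lt1 : ∀ᵐ z ∂ν, f1 z.1 < ⊤ :=
    ae_of_ae_map measurable_fst.aemeasurable (ac1.ae_le (Measure.rnDeriv_lt_top _ _))
  have lt2 : ∀ᵐ z ∂ν, f2 z.2 < ⊤ :=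
    ae_of_ae_map measurable_snd.aemeasurable (ac2.ae_le (Measure.rnDeriv_lt_top _ _))
  have ac3 : ν ≪ ν.fst.prod ν.snd := by
    refine Measure.AbsolutelyContinuous.mk fun A hA h0 => ?_
    rw [hprod, withDensity_apply_eq_zero mm] at h0
    have h1 := hac h0
    rw [measure_eq_zero_iff_ae_notMem] at h1 ⊢
    filter_upwards [h1, pos1, pos2] with z hz p1 p2 hzA
    exact hz ⟨mul_ne_zero p1.ne' p2.ne', hzA⟩
  have e1 := hac.ae_le (Measure.rnDeriv_mul_rnDeriv (κ := P₁.prod P₂) ac3)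
  have e2 : (ν.fst.prod ν.snd).rnDeriv (P₁.prod P₂) =ᵐ[ν] fun z => f1 z.1 * f2 z.2 := by
    rw [hprod]
    exact hac.ae_le (Measure.rnDeriv_withDensity _ mm)
  have pos3 := Measure.rnDeriv_pos ac3
  have lt3 := ac3.ae_le (Measure.rnDeriv_lt_top ν (ν.fst.prod ν.snd))
  have key : llr ν (P₁.prod P₂) =ᵐ[ν] fun z => llr ν (ν.fst.prod ν.snd) z
      + (llr ν.fst P₁ z.1 + llr ν.snd P₂ z.2) := by
    filter_upwards [e1, e2, pos1, pos2, lt1, lt2, pos3, lt3] with z e1 e2 p1 p2 l1 l2 p3 l3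
    rw [Pi.mul_apply, e2] at e1
    have r1 := (ENNReal.toReal_pos p1.ne' l1.ne).ne'
    have r2 := (ENNReal.toReal_pos p2.ne' l2.ne).ne'
    have r3 := (ENNReal.toReal_pos p3.ne' l3.ne).ne'
    simp only [llr_def]
    rw [← e1, ENNReal.toReal_mul, ENNReal.toReal_mul, Real.log_mul r3 (mul_ne_zero r1 r2),
      Real.log_mul r1 r2]
  have i1 : Integrable (fun z : Ω₁ × Ω₂ => llr ν.fst P₁ z.1) ν := int1.comp_measurable measurable_fst
  have i2 : Integrable (fun z : Ω₁ × Ω₂ => llr ν.snd P₂ z.2) ν := int2.comp_measurable measurable_snd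
  have i3 : Integrable (llr ν (ν.fst.prod ν.snd)) ν := by
    refine (hint.sub (i1.add i2)).congr ?_
    filter_upwards [key] with z hz
    simp [hz]
  have t3 := klDiv_ne_top ac3 i3
  have i12 : Integrable (fun z : Ω₁ × Ω₂ => llr ν.fst P₁ z.1 + llr ν.snd P₂ z.2) ν := i1.add i2
  rw [← ENNReal.toReal_eq_toReal_iff' htop (by simp [t1, t2, t3]), ENNReal.toReal_add t3 (by simp [t1, t2]),
    ENNReal.toReal_add t1 t2, toReal_klDiv_of_measure_eq hac (by simp),
    toReal_klDiv_of_measure_eq ac1 (by simp), toReal_klDiv_of_measure_eq ac2 (by simp),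
    toReal_klDiv_of_measure_eq ac3 (by simp), integral_congr_ae key,
    integral_add i3 i12, integral_add i1 i2]
  congr 2
  · exact (integral_map measurable_fst.aemeasurable
      int1.aestronglyMeasurable).symm
  · exact (integral_map measurable_snd.aemeasurable
      int2.aestronglyMeasurable).symm

/-- `H_{P₁×P₂}(ν) ≥ H_{P₁}(ν₁) + H_{P₂}(ν₂)` and `H_{P₁×P₂}(ν) ≥ H_{ν₁×ν₂}(ν)`. -/
theorem relEnt_prod_ge {Ω₁ Ω₂ : Type*} [MeasurableSpace Ω₁] [MeasurableSpace Ω₂]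
    (P₁ : Measure Ω₁) (P₂ : Measure Ω₂) [IsProbabilityMeasure P₁] [IsProbabilityMeasure P₂]
    (ν : Measure (Ω₁ × Ω₂)) [IsProbabilityMeasure ν] :
    relEnt ν.fst P₁ + relEnt ν.snd P₂ ≤ relEnt ν (P₁.prod P₂) ∧
      relEnt ν (ν.fst.prod ν.snd) ≤ relEnt ν (P₁.prod P₂) := by
  simp only [relEnt_eq_klDiv]
  by_cases htop : InformationTheory.klDiv ν (P₁.prod P₂) = ⊤
  · simp [htop]
  rw [klDiv_prod_eq P₁ P₂ ν htop, ← EReal.coe_ennreal_add, EReal.coe_ennreal_le_coe_ennreal_iff,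
    EReal.coe_ennreal_le_coe_ennreal_iff]
  exact ⟨le_add_self, le_self_add⟩
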